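/- Let G be a directed polymatroidal network and let x ∈ ℝ^{V∪E} be any vector satisfying ∑_{v∈V} deg_v x_v = 0 and ∑_{v∈V} deg_v x_v² > 0. Then there exists a set S ⊆ V with 0 < vol(S) ≤ vol(V)/2 such that symcutval(S) ≤ 128 · √(R̄(x)) · vol(S). -/

import Mathlib

open MeasureTheory

/-- Lovász extension of the set function `f`, with ground set `D`,
evaluated at the (nonnegative) vector `x`. -/
noncomputable def lovOn {E : Type*} (f : Set E → ℝ) (D : Set E) (x : E → ℝ) : ℝ :=
  ∫ θ in Set.Ioi (0 : ℝ), f (D ∩ {e | θ ≤ x e})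

/-- A directed polymatroidal network on vertex type `V` and edge type `E`. -/
structure PolyNet (V E : Type*) [Fintype V] [Fintype E] where
  tail : E → V
  head : E → V
  w : V → ℝ
  w_nonneg : ∀ v, 0 ≤ w v
  ρp : V → Set E → ℝ
  ρm : V → Set E → ℝ
  ρp_nonneg : ∀ v A, 0 ≤ ρp v A
  ρm_nonneg : ∀ v A, 0 ≤ ρm v A
  ρp_empty : ∀ v, ρp v ∅ = 0
  ρm_empty : ∀ v, ρm v ∅ = 0
  ρp_mono : ∀ v A B, A ⊆ B → B ⊆ {e | tail e = v} → ρp v A ≤ ρp v B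
  ρm_mono : ∀ v A B, A ⊆ B → B ⊆ {e | head e = v} → ρm v A ≤ ρm v B
  ρp_submod : ∀ v A B, A ⊆ {e | tail e = v} → B ⊆ {e | tail e = v} →
    ρp v (A ∪ B) + ρp v (A ∩ B) ≤ ρp v A + ρp v B
  ρm_submod : ∀ v A B, A ⊆ {e | head e = v} → B ⊆ {e | head e = v} →
    ρm v (A ∪ B) + ρm v (A ∩ B) ≤ ρm v A + ρm v B

namespace PolyNet

variable {V E : Type*} [Fintype V] [Fintype E] (N : PolyNet V E)

/-- The set of edges leaving `v`. -/
def outE (v : V) : Set E := {e | N.tail e = v}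

/-- The set of edges entering `v`. -/
def inE (v : V) : Set E := {e | N.head e = v}

/-- The degree of a vertex. -/
noncomputable def deg (v : V) : ℝ := N.ρp v (N.outE v) + N.ρm v (N.inE v)

/-- The volume of a set of vertices. -/
noncomputable def vol (S : Set V) : ℝ := ∑ v, S.indicator N.deg v

/-- The total weight of a set of vertices. -/
noncomputable def wsum (S : Set V) : ℝ := ∑ v, S.indicator N.w v

/-- An assignment `g` of (cut) edges to vertices is valid on `F` if every edge of `F` is
assigned to one of its endpoints. -/
def valid (F : Set E) (g : E → V) : Prop := ∀ e ∈ F, g e = N.tail e ∨ g e = N.head e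

/-- The cost of the cut `F` under the assignment `g`. -/
noncomputable def cutCost (F : Set E) (g : E → V) : ℝ :=
  ∑ v, (N.ρp v (N.outE v ∩ F ∩ {e | g e = v}) + N.ρm v (N.inE v ∩ F ∩ {e | g e = v}))

/-- The cost of the cut `F`: minimum over valid assignments. -/
noncomputable def cut (F : Set E) : ℝ :=
  sInf {c | ∃ g : E → V, N.valid F g ∧ c = N.cutCost F g}

/-- Edges from `S` to its complement. -/
def dplus (S : Set V) : Set E := {e | N.tail e ∈ S ∧ N.head e ∉ S}

/-- Edges from the complement of `S` into `S`. -/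
def dminus (S : Set V) : Set E := {e | N.tail e ∉ S ∧ N.head e ∈ S}

/-- The (directed) value of the cut induced by `S`. -/
noncomputable def cutval (S : Set V) : ℝ := min (N.cut (N.dplus S)) (N.cut (N.dminus S))

/-- The symmetric value of the cut induced by `S`. -/
noncomputable def symcutval (S : Set V) : ℝ := N.cut (N.dplus S) + N.cut (N.dminus S)

/-- The Rayleigh quotient `R⁺`. -/
noncomputable def Rp (x : V ⊕ E → ℝ) : ℝ :=
  (∑ v, (lovOn (N.ρp v) (N.outE v) (fun e => (max 0 (x (Sum.inl v) - x (Sum.inr e)))^2)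
       + lovOn (N.ρm v) (N.inE v) (fun e => (max 0 (x (Sum.inr e) - x (Sum.inl v)))^2)))
  / ∑ v, N.deg v * (x (Sum.inl v))^2

/-- The Rayleigh quotient `R⁻`. -/
noncomputable def Rm (x : V ⊕ E → ℝ) : ℝ :=
  (∑ v, (lovOn (N.ρp v) (N.outE v) (fun e => (max 0 (x (Sum.inr e) - x (Sum.inl v)))^2)
       + lovOn (N.ρm v) (N.inE v) (fun e => (max 0 (x (Sum.inl v) - x (Sum.inr e)))^2)))
  / ∑ v, N.deg v * (x (Sum.inl v))^2

/-- The Rayleigh quotient `R`. -/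
noncomputable def Ray (x : V ⊕ E → ℝ) : ℝ := min (N.Rp x) (N.Rm x)

/-- The symmetric Rayleigh quotient `R̄`. -/
noncomputable def RaySym (x : V ⊕ E → ℝ) : ℝ := N.Rp x + N.Rm x

/-- The spectral gap `γ₂` of a polymatroidal network. -/
noncomputable def gap : ℝ :=
  sInf {r | ∃ x : V ⊕ E → ℝ, (∑ v, N.deg v * x (Sum.inl v)) = 0 ∧
    (0 < ∑ v, N.deg v * (x (Sum.inl v))^2) ∧ r = N.Ray x}

end PolyNet

/-- The values of `f` on the superlevel sets of `c` within `D`. -/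
def levelValue {E : Type*} (f : Set E → ℝ) (D : Set E) (c : E → ℝ) (r : ℝ) : ℝ :=
  f (D ∩ {e | r ≤ c e})

section LevelValue

variable {E : Type*} {f : Set E → ℝ} {D : Set E}

lemma levelValue_antitone (hmono : ∀ A B, A ⊆ B → B ⊆ D → f A ≤ f B) (c : E → ℝ) :
    Antitone (levelValue f D c) := fun _ _ hab =>
  hmono _ _ (Set.inter_subset_inter_right _ fun _ he => hab.trans he) Set.inter_subset_left

lemma levelValue_eventually_zero [Finite E] (hempty : f ∅ = 0) (c : E → ℝ) :
    ∃ M, ∀ r, M < r → levelValue f D c r = 0 := by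
  obtain ⟨M, hM⟩ := (Set.finite_range c).bddAbove
  refine ⟨M, fun r hr => ?_⟩
  have : D ∩ {e | r ≤ c e} = ∅ := by
    ext e
    simp only [Set.mem_inter_iff, Set.mem_ofPred_eq, Set.mem_empty_iff_false, iff_false, not_and,
      not_le]
    exact fun _ => (hM ⟨e, rfl⟩).trans_lt hr
  rw [levelValue, this, hempty]

lemma lovOn_sq_posPart (c : E → ℝ) :
    lovOn f D (fun e => (max 0 (c e)) ^ 2) =
      ∫ r in Set.Ioi (0 : ℝ), 2 * r * levelValue f D c r := by
  rw [lovOn, ← integral_comp_rpow_Ioi_of_pos (p := 2) two_pos]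
  refine setIntegral_congr_fun measurableSet_Ioi fun r hr => ?_
  have hr' : (0 : ℝ) < r := hr
  have hset : {e | r ^ (2 : ℝ) ≤ (max 0 (c e)) ^ 2} = {e | r ≤ c e} := by
    ext e
    simp only [Set.mem_ofPred_eq, Real.rpow_two]
    rw [pow_le_pow_iff_left₀ hr'.le (le_max_left _ _) two_ne_zero, le_max_iff]
    exact ⟨fun h => h.resolve_left hr'.not_ge, Or.inr⟩
  simp only [smul_eq_mul, levelValue, hset]
  norm_num

/-- Contribution of the edges in `D` whose value is below `s`, at a vertex of value `y ≥ s`. -/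
noncomputable def lowerTerm (f : Set E → ℝ) (D : Set E) (y : ℝ) (z : E → ℝ) (s : ℝ) : ℝ :=
  if s ≤ y then levelValue f D (fun e => y - z e) (y - s) else 0

/-- Contribution of the edges in `D` whose value is at least `s`, at a vertex of value `y < s`. -/
noncomputable def upperTerm (f : Set E → ℝ) (D : Set E) (y : ℝ) (z : E → ℝ) (s : ℝ) : ℝ :=
  if y < s then levelValue f D (fun e => z e - y) (s - y) else 0

lemma lowerTerm_eq (hf : f ∅ = 0) (y : ℝ) (z : E → ℝ) (s : ℝ) :
    lowerTerm f D y z s = f (D ∩ {e | s ≤ y ∧ z e ≤ s}) := by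
  unfold lowerTerm levelValue
  split_ifs with h
  · simp only [sub_le_sub_iff_left, h, true_and]
  · simp [h, hf]

lemma upperTerm_eq (hf : f ∅ = 0) (y : ℝ) (z : E → ℝ) (s : ℝ) :
    upperTerm f D y z s = f (D ∩ {e | y < s ∧ s ≤ z e}) := by
  unfold upperTerm levelValue
  split_ifs with h
  · simp [h]
  · simp [h, hf]

end LevelValue

section Antitone

variable {h : ℝ → ℝ} {d M : ℝ}

lemma integrableOn_continuous_mul_antitone (hanti : Antitone h) (hM : ∀ r, M < r → h r = 0)
    {c : ℝ → ℝ} (hc : Continuous c) : IntegrableOn (fun r => c r * h r) (Set.Ioi 0) := by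
  have h1 : IntegrableOn (fun r => c r * h r) (Set.Ioc 0 (max 0 M)) :=
    (intervalIntegrable_iff_integrableOn_Ioc_of_le (le_max_left 0 M)).1
      (hanti.intervalIntegrable.continuousOn_mul hc.continuousOn)
  refine h1.of_forall_sdiff_eq_zero measurableSet_Ioi fun r hr => ?_
  have hr0 : (0 : ℝ) < r := hr.1
  have : M < r := by
    by_contra hcon
    exact hr.2 ⟨hr0, (not_lt.1 hcon).trans (le_max_right _ _)⟩
  rw [hM r this, mul_zero]

lemma integral_add_const_mul_antitone_le (hanti : Antitone h) (hM : ∀ r, M < r → h r = 0)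
    (h0 : ∀ r, 0 ≤ h r) (hd : ∀ r, h r ≤ d) {ε Y : ℝ} (hε : 0 < ε) (hY : 0 ≤ Y) :
    ∫ r in Set.Ioi (0 : ℝ), (2 * r + 2 * Y) * h r ≤
      2 * ε * d * Y ^ 2 + (1 / ε + 1) * ∫ r in Set.Ioi (0 : ℝ), 2 * r * h r := by
  have hint : IntegrableOn (fun r => (1 / ε + 1) * (2 * r * h r)) (Set.Ioi 0) :=
    (integrableOn_continuous_mul_antitone hanti hM (c := fun r => 2 * r)
      (by fun_prop)).const_mul _
  have hind : IntegrableOn ((Set.Ioc 0 (ε * Y)).indicator fun _ => 2 * Y * d) (Set.Ioi 0) := by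
    refine Integrable.integrableOn ?_
    rw [integrable_indicator_iff measurableSet_Ioc]
    exact integrableOn_const (by simp)
  have hval : ∫ r in Set.Ioi (0 : ℝ), (Set.Ioc 0 (ε * Y)).indicator (fun _ => 2 * Y * d) r =
      2 * ε * d * Y ^ 2 := by
    rw [setIntegral_indicator measurableSet_Ioc,
      Set.inter_eq_right.2 Set.Ioc_subset_Ioi_self, setIntegral_const]
    have : 0 ≤ ε * Y := by positivity
    simp [Measure.real, this]
    ring
  rw [← hval, ← integral_const_mul, ← integral_add hind hint]
  refine setIntegral_mono_on
    (integrableOn_continuous_mul_antitone hanti hM (c := fun r => 2 * r + 2 * Y) (by fun_prop))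
    (hind.add hint) measurableSet_Ioi fun r hr => ?_
  have hr0 : (0 : ℝ) < r := hr
  have hh := h0 r
  by_cases hrY : r ≤ ε * Y
  · rw [Set.indicator_of_mem (show r ∈ Set.Ioc 0 (ε * Y) from ⟨hr, hrY⟩)]
    have h1 : 2 * Y * h r ≤ 2 * Y * d := mul_le_mul_of_nonneg_left (hd r) (by positivity)
    have h2 : 0 ≤ 1 / ε * (2 * r * h r) := by positivity
    linarith
  · rw [Set.indicator_of_notMem (fun hmem => hrY hmem.2)]
    have h1 : Y ≤ 1 / ε * r := by
      rw [one_div_mul_eq_div, le_div_iff₀ hε]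
      linarith
    have h2 : Y * (2 * h r) ≤ 1 / ε * r * (2 * h r) :=
      mul_le_mul_of_nonneg_right h1 (by positivity)
    linarith

lemma integrable_and_integral_le_of_le (hanti : Antitone h) (hM : ∀ r, M < r → h r = 0)
    {φ : ℝ → ℝ} (hφ : Measurable φ) {Y : ℝ} (hφ0 : ∀ r, 0 ≤ φ r)
    (hle : ∀ r, φ r ≤ (Set.Ici 0).indicator (fun r => (2 * r + 2 * Y) * h r) r) :
    Integrable φ ∧ ∫ r, φ r ≤ ∫ r in Set.Ioi (0 : ℝ), (2 * r + 2 * Y) * h r := by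
  have hint : Integrable ((Set.Ici 0).indicator fun r => (2 * r + 2 * Y) * h r) := by
    rw [integrable_indicator_iff measurableSet_Ici, integrableOn_Ici_iff_integrableOn_Ioi]
    exact integrableOn_continuous_mul_antitone hanti hM (by fun_prop)
  have hφint : Integrable φ := hint.mono' hφ.aestronglyMeasurable
    (Filter.Eventually.of_forall fun r => by
      rw [Real.norm_of_nonneg (hφ0 r)]
      exact hle r)
  refine ⟨hφint, ?_⟩
  rw [← integral_Ici_eq_integral_Ioi, ← integral_indicator measurableSet_Ici]
  exact integral_mono hφint hint hle

lemma lower_sweep (hanti : Antitone h) (hM : ∀ r, M < r → h r = 0)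
    (h0 : ∀ r, 0 ≤ h r) (hd : ∀ r, h r ≤ d) (y : ℝ) :
    IntegrableOn (fun s => 2 * s * if s ≤ y then h (y - s) else 0) (Set.Ioi 0) ∧
    ∀ ε, 0 < ε → ∫ s in Set.Ioi (0 : ℝ), (2 * s * if s ≤ y then h (y - s) else 0) ≤
      2 * ε * d * (max 0 y) ^ 2 + (1 / ε + 1) * ∫ r in Set.Ioi (0 : ℝ), 2 * r * h r := by
  set φ : ℝ → ℝ := (Set.Ico 0 y).indicator fun r => 2 * (y - r) * h r with hφdef
  have hφm : Measurable φ :=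
    ((by fun_prop : Measurable fun r : ℝ => 2 * (y - r)).mul hanti.measurable).indicator
      measurableSet_Ico
  have hφ0 : ∀ r, 0 ≤ φ r := fun r => Set.indicator_nonneg
    (fun r hr => mul_nonneg (by linarith [hr.2]) (h0 r)) r
  have hle : ∀ r, φ r ≤
      (Set.Ici 0).indicator (fun r => (2 * r + 2 * max 0 y) * h r) r := by
    intro r
    by_cases hr : r ∈ Set.Ico 0 y
    · rw [hφdef, Set.indicator_of_mem hr, Set.indicator_of_mem (show r ∈ Set.Ici 0 from hr.1)]
      exact mul_le_mul_of_nonneg_right (by linarith [le_max_right 0 y, hr.1]) (h0 r)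
    · rw [hφdef, Set.indicator_of_notMem hr]
      exact Set.indicator_nonneg (fun r hr => mul_nonneg
        (add_nonneg (by linarith [Set.mem_Ici.1 hr]) (by positivity)) (h0 r)) r
  obtain ⟨hi, hb⟩ := integrable_and_integral_le_of_le hanti hM hφm hφ0 hle
  have heq : (fun s => φ (y - s)) =
      (Set.Ioi 0).indicator fun s => 2 * s * if s ≤ y then h (y - s) else 0 := by
    funext s
    simp only [hφdef, Set.indicator_apply, Set.mem_Ico, Set.mem_Ioi, sub_nonneg, sub_lt_self_iff]
    by_cases h1 : s ≤ y <;> by_cases h2 : 0 < s <;> simp [h1, h2]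
  refine ⟨?_, fun ε hε => ?_⟩
  · rw [← integrable_indicator_iff measurableSet_Ioi, ← heq]
    exact hi.comp_sub_left y
  · rw [← integral_indicator measurableSet_Ioi, ← heq, integral_sub_left_eq_self φ volume y]
    exact hb.trans (integral_add_const_mul_antitone_le hanti hM h0 hd hε (le_max_left _ _))

lemma upper_sweep (hanti : Antitone h) (hM : ∀ r, M < r → h r = 0)
    (h0 : ∀ r, 0 ≤ h r) (hd : ∀ r, h r ≤ d) (y : ℝ) :
    IntegrableOn (fun s => 2 * s * if y < s then h (s - y) else 0) (Set.Ioi 0) ∧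
    ∀ ε, 0 < ε → ∫ s in Set.Ioi (0 : ℝ), (2 * s * if y < s then h (s - y) else 0) ≤
      2 * ε * d * (max 0 y) ^ 2 + (1 / ε + 1) * ∫ r in Set.Ioi (0 : ℝ), 2 * r * h r := by
  set φ : ℝ → ℝ := (Set.Ioi (max 0 (-y))).indicator fun r => 2 * (r + y) * h r with hφdef
  have hφm : Measurable φ :=
    ((by fun_prop : Measurable fun r : ℝ => 2 * (r + y)).mul hanti.measurable).indicator
      measurableSet_Ioi
  have hφ0 : ∀ r, 0 ≤ φ r := fun r => Set.indicator_nonneg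
    (fun r hr => mul_nonneg (by linarith [(max_lt_iff.1 (Set.mem_Ioi.1 hr)).2]) (h0 r)) r
  have hle : ∀ r, φ r ≤
      (Set.Ici 0).indicator (fun r => (2 * r + 2 * max 0 y) * h r) r := by
    intro r
    by_cases hr : r ∈ Set.Ioi (max 0 (-y))
    · rw [hφdef, Set.indicator_of_mem hr,
        Set.indicator_of_mem (Set.mem_Ici.2 (max_lt_iff.1 (Set.mem_Ioi.1 hr)).1.le)]
      exact mul_le_mul_of_nonneg_right (by linarith [le_max_right 0 y]) (h0 r)
    · rw [hφdef, Set.indicator_of_notMem hr]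
      exact Set.indicator_nonneg (fun r hr => mul_nonneg
        (add_nonneg (by linarith [Set.mem_Ici.1 hr]) (by positivity)) (h0 r)) r
  obtain ⟨hi, hb⟩ := integrable_and_integral_le_of_le hanti hM hφm hφ0 hle
  have heq : (fun s => φ (s - y)) =
      (Set.Ioi 0).indicator fun s => 2 * s * if y < s then h (s - y) else 0 := by
    funext s
    simp only [hφdef, Set.indicator_apply, Set.mem_Ioi, max_lt_iff, sub_pos]
    have : -y < s - y ↔ 0 < s := by constructor <;> intro <;> linarith
    simp only [this]
    by_cases h1 : y < s <;> by_cases h2 : 0 < s <;> simp [h1, h2]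
  refine ⟨?_, fun ε hε => ?_⟩
  · rw [← integrable_indicator_iff measurableSet_Ioi, ← heq]
    exact hi.comp_sub_right y
  · rw [← integral_indicator measurableSet_Ioi, ← heq, integral_sub_right_eq_self φ y]
    exact hb.trans (integral_add_const_mul_antitone_le hanti hM h0 hd hε (le_max_left _ _))

end Antitone

lemma integral_threshold (y : ℝ) :
    IntegrableOn (fun s => 2 * s * if s ≤ y then (1 : ℝ) else 0) (Set.Ioi 0) ∧
    ∫ s in Set.Ioi (0 : ℝ), (2 * s * if s ≤ y then (1 : ℝ) else 0) = (max 0 y) ^ 2 := by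
  have heq : ((Set.Ioi 0).indicator fun s => 2 * s * if s ≤ y then (1 : ℝ) else 0) =
      (Set.Ioc 0 (max 0 y)).indicator fun s => 2 * s := by
    funext s
    simp only [Set.indicator_apply, Set.mem_Ioi, Set.mem_Ioc, le_max_iff]
    by_cases h2 : 0 < s
    · simp [h2, h2.not_ge]
    · simp [h2]
  constructor
  · rw [← integrable_indicator_iff measurableSet_Ioi, heq,
      integrable_indicator_iff measurableSet_Ioc,
      ← intervalIntegrable_iff_integrableOn_Ioc_of_le (le_max_left 0 y)]
    exact (by fun_prop : Continuous fun s : ℝ => 2 * s).intervalIntegrable _ _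
  · rw [← integral_indicator measurableSet_Ioi, heq, integral_indicator measurableSet_Ioc,
      ← intervalIntegral.integral_of_le (le_max_left 0 y), intervalIntegral.integral_const_mul,
      integral_id]
    ring

section Terms

variable {E : Type*} [Finite E] {f : Set E → ℝ} {D : Set E}

lemma integral_lowerTerm_le (hf0 : ∀ A, 0 ≤ f A) (hempty : f ∅ = 0)
    (hmono : ∀ A B, A ⊆ B → B ⊆ D → f A ≤ f B) (y : ℝ) (z : E → ℝ) :
    IntegrableOn (fun s => 2 * s * lowerTerm f D y z s) (Set.Ioi 0) ∧
    ∀ ε, 0 < ε → ∫ s in Set.Ioi (0 : ℝ), 2 * s * lowerTerm f D y z s ≤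
      2 * ε * f D * (max 0 y) ^ 2 + (1 / ε + 1) * lovOn f D fun e => (max 0 (y - z e)) ^ 2 := by
  obtain ⟨M, hM⟩ := levelValue_eventually_zero (D := D) hempty fun e => y - z e
  rw [lovOn_sq_posPart]
  exact lower_sweep (levelValue_antitone hmono _) hM (fun _ => hf0 _)
    (fun _ => hmono _ _ Set.inter_subset_left subset_rfl) y

lemma integral_upperTerm_le (hf0 : ∀ A, 0 ≤ f A) (hempty : f ∅ = 0)
    (hmono : ∀ A B, A ⊆ B → B ⊆ D → f A ≤ f B) (y : ℝ) (z : E → ℝ) :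
    IntegrableOn (fun s => 2 * s * upperTerm f D y z s) (Set.Ioi 0) ∧
    ∀ ε, 0 < ε → ∫ s in Set.Ioi (0 : ℝ), 2 * s * upperTerm f D y z s ≤
      2 * ε * f D * (max 0 y) ^ 2 + (1 / ε + 1) * lovOn f D fun e => (max 0 (z e - y)) ^ 2 := by
  obtain ⟨M, hM⟩ := levelValue_eventually_zero (D := D) hempty fun e => z e - y
  rw [lovOn_sq_posPart]
  exact upper_sweep (levelValue_antitone hmono _) hM (fun _ => hf0 _)
    (fun _ => hmono _ _ Set.inter_subset_left subset_rfl) y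

end Terms

namespace PolyNet

variable {V E : Type*} [Fintype V] [Fintype E] (N : PolyNet V E)

lemma deg_nonneg (v : V) : 0 ≤ N.deg v := add_nonneg (N.ρp_nonneg _ _) (N.ρm_nonneg _ _)

lemma vol_nonneg (S : Set V) : 0 ≤ N.vol S :=
  Finset.sum_nonneg fun v _ => Set.indicator_nonneg (fun v _ => N.deg_nonneg v) v

lemma vol_mono {S T : Set V} (h : S ⊆ T) : N.vol S ≤ N.vol T :=
  Finset.sum_le_sum fun v _ =>
    Set.indicator_le_indicator_of_subset h (fun v => N.deg_nonneg v) v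

lemma vol_add_vol_compl (S : Set V) : N.vol S + N.vol Sᶜ = N.vol Set.univ := by
  simp only [vol, ← Finset.sum_add_distrib, Set.indicator_univ]
  exact Finset.sum_congr rfl fun v _ => Set.indicator_self_add_compl_apply S N.deg v

lemma vol_pos_of_mem {S : Set V} {v : V} (hv : v ∈ S) (hdeg : 0 < N.deg v) : 0 < N.vol S :=
  Finset.sum_pos' (fun u _ => Set.indicator_nonneg (fun u _ => N.deg_nonneg u) u)
    ⟨v, Finset.mem_univ v, by rwa [Set.indicator_of_mem hv]⟩

lemma cutCost_nonneg (F : Set E) (g : E → V) : 0 ≤ N.cutCost F g :=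
  Finset.sum_nonneg fun _ _ => add_nonneg (N.ρp_nonneg _ _) (N.ρm_nonneg _ _)

lemma cut_nonneg (F : Set E) : 0 ≤ N.cut F := by
  refine Real.sInf_nonneg ?_
  rintro c ⟨g, -, rfl⟩
  exact N.cutCost_nonneg F g

lemma cut_le_cutCost {F : Set E} {g : E → V} (hg : N.valid F g) : N.cut F ≤ N.cutCost F g := by
  refine csInf_le ⟨0, ?_⟩ ⟨g, hg, rfl⟩
  rintro c ⟨g, -, rfl⟩
  exact N.cutCost_nonneg F g

lemma cut_le_of_subset {F : Set E} {g : E → V} (hg : N.valid F g) {A B : V → Set E}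
    (hA : ∀ v, A v ⊆ N.outE v) (hB : ∀ v, B v ⊆ N.inE v)
    (hFA : ∀ e ∈ F, g e = N.tail e → e ∈ A (N.tail e))
    (hFB : ∀ e ∈ F, g e = N.head e → e ∈ B (N.head e)) :
    N.cut F ≤ ∑ v, (N.ρp v (A v) + N.ρm v (B v)) := by
  refine (N.cut_le_cutCost hg).trans (Finset.sum_le_sum fun v _ => add_le_add ?_ ?_)
  · refine N.ρp_mono v _ _ ?_ (hA v)
    rintro e ⟨⟨rfl, he⟩, hge⟩
    exact hFA e he hge
  · refine N.ρm_mono v _ _ ?_ (hB v)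
    rintro e ⟨⟨rfl, he⟩, hge⟩
    exact hFB e he hge

lemma symcutval_nonneg (S : Set V) : 0 ≤ N.symcutval S :=
  add_nonneg (N.cut_nonneg _) (N.cut_nonneg _)

open Classical in
lemma symcutval_le_vol (S : Set V) : N.symcutval S ≤ N.vol S := by
  have h1 : N.cut (N.dplus S) ≤ ∑ v, (N.ρp v (if v ∈ S then N.outE v else ∅) + N.ρm v ∅) := by
    refine N.cut_le_of_subset (g := fun e => N.tail e) (A := fun v => if v ∈ S then N.outE v else ∅)
      (B := fun _ => ∅) (fun e _ => Or.inl rfl) ?_ (fun _ => Set.empty_subset _) ?_ ?_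
    · intro v
      split_ifs <;> simp
    · rintro e ⟨ht, -⟩ -
      simp [ht, outE]
    · rintro e ⟨ht, hh⟩ heq
      exact absurd (heq ▸ ht) hh
  have h2 : N.cut (N.dminus S) ≤ ∑ v, (N.ρp v ∅ + N.ρm v (if v ∈ S then N.inE v else ∅)) := by
    refine N.cut_le_of_subset (g := fun e => N.head e) (A := fun _ => ∅)
      (B := fun v => if v ∈ S then N.inE v else ∅) (fun e _ => Or.inr rfl)
      (fun _ => Set.empty_subset _) ?_ ?_ ?_
    · intro v
      split_ifs <;> simp
    · rintro e ⟨ht, hh⟩ heq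
      exact absurd (heq ▸ hh) ht
    · rintro e ⟨-, hh⟩ -
      simp [hh, inE]
  refine (add_le_add h1 h2).trans (le_of_eq ?_)
  rw [vol, ← Finset.sum_add_distrib]
  refine Finset.sum_congr rfl fun v _ => ?_
  by_cases hv : v ∈ S <;> simp [hv, N.ρp_empty, N.ρm_empty, deg]

/-- The vertices whose value is at least `s`. -/
def superlevel (y : V ⊕ E → ℝ) (s : ℝ) : Set V := {v | s ≤ y (Sum.inl v)}

lemma cut_dplus_superlevel_le (y : V ⊕ E → ℝ) (s : ℝ) :
    N.cut (N.dplus (superlevel y s)) ≤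
      ∑ v, (lowerTerm (N.ρp v) (N.outE v) (y (Sum.inl v)) (fun e => y (Sum.inr e)) s +
        upperTerm (N.ρm v) (N.inE v) (y (Sum.inl v)) (fun e => y (Sum.inr e)) s) := by
  simp only [lowerTerm_eq (N.ρp_empty _), upperTerm_eq (N.ρm_empty _)]
  refine N.cut_le_of_subset
    (g := fun e => if y (Sum.inr e) < s then N.tail e else N.head e) ?_
    (fun _ => Set.inter_subset_left) (fun _ => Set.inter_subset_left) ?_ ?_
  · intro e _
    dsimp only
    split_ifs <;> simp
  · rintro e ⟨ht, hh⟩ hg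
    split_ifs at hg with h
    · exact ⟨rfl, ht, h.le⟩
    · exact absurd (hg ▸ ht) hh
  · rintro e ⟨ht, hh⟩ hg
    split_ifs at hg with h
    · exact absurd (hg ▸ ht) hh
    · exact ⟨rfl, not_le.1 hh, not_lt.1 h⟩

lemma cut_dminus_superlevel_le (y : V ⊕ E → ℝ) (s : ℝ) :
    N.cut (N.dminus (superlevel y s)) ≤
      ∑ v, (upperTerm (N.ρp v) (N.outE v) (y (Sum.inl v)) (fun e => y (Sum.inr e)) s +
        lowerTerm (N.ρm v) (N.inE v) (y (Sum.inl v)) (fun e => y (Sum.inr e)) s) := by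
  simp only [lowerTerm_eq (N.ρm_empty _), upperTerm_eq (N.ρp_empty _)]
  refine N.cut_le_of_subset
    (g := fun e => if y (Sum.inr e) < s then N.head e else N.tail e) ?_
    (fun _ => Set.inter_subset_left) (fun _ => Set.inter_subset_left) ?_ ?_
  · intro e _
    dsimp only
    split_ifs <;> simp
  · rintro e ⟨ht, hh⟩ hg
    split_ifs at hg with h
    · exact absurd (hg ▸ hh) ht
    · exact ⟨rfl, not_le.1 ht, not_lt.1 h⟩
  · rintro e ⟨ht, hh⟩ hg
    split_ifs at hg with h
    · exact ⟨rfl, hh, h.le⟩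
    · exact absurd (hg ▸ hh) ht

/-- The numerator of the symmetric Rayleigh quotient. -/
noncomputable def energy (x : V ⊕ E → ℝ) : ℝ :=
  ∑ v, (lovOn (N.ρp v) (N.outE v) (fun e => (max 0 (x (Sum.inl v) - x (Sum.inr e)))^2)
      + lovOn (N.ρm v) (N.inE v) (fun e => (max 0 (x (Sum.inr e) - x (Sum.inl v)))^2)) +
  ∑ v, (lovOn (N.ρp v) (N.outE v) (fun e => (max 0 (x (Sum.inr e) - x (Sum.inl v)))^2)
      + lovOn (N.ρm v) (N.inE v) (fun e => (max 0 (x (Sum.inl v) - x (Sum.inr e)))^2))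

lemma RaySym_eq (x : V ⊕ E → ℝ) :
    N.RaySym x = N.energy x / ∑ v, N.deg v * (x (Sum.inl v)) ^ 2 := by
  rw [RaySym, Rp, Rm, energy, add_div]

lemma energy_nonneg (x : V ⊕ E → ℝ) : 0 ≤ N.energy x := by
  have h : ∀ (f : Set E → ℝ) (D : Set E) (z : E → ℝ), (∀ A, 0 ≤ f A) → 0 ≤ lovOn f D z :=
    fun f D z hf => integral_nonneg fun _ => hf _
  exact add_nonneg
    (Finset.sum_nonneg fun v _ => add_nonneg (h _ _ _ (N.ρp_nonneg v)) (h _ _ _ (N.ρm_nonneg v)))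
    (Finset.sum_nonneg fun v _ => add_nonneg (h _ _ _ (N.ρp_nonneg v)) (h _ _ _ (N.ρm_nonneg v)))

lemma energy_sub_const (x : V ⊕ E → ℝ) (c : ℝ) : N.energy (fun i => x i - c) = N.energy x := by
  simp only [energy, sub_sub_sub_cancel_right]

lemma energy_neg (x : V ⊕ E → ℝ) : N.energy (fun i => -x i) = N.energy x := by
  simp only [energy, neg_sub_neg]
  rw [add_comm]

/-- The upper bound for the symmetric cut at level `s`, weighted by `2 * s`. -/
noncomputable def sweepBound (y : V ⊕ E → ℝ) (s : ℝ) : ℝ :=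
  ∑ v, (2 * s * lowerTerm (N.ρp v) (N.outE v) (y (Sum.inl v)) (fun e => y (Sum.inr e)) s +
      2 * s * upperTerm (N.ρm v) (N.inE v) (y (Sum.inl v)) (fun e => y (Sum.inr e)) s) +
  ∑ v, (2 * s * upperTerm (N.ρp v) (N.outE v) (y (Sum.inl v)) (fun e => y (Sum.inr e)) s +
      2 * s * lowerTerm (N.ρm v) (N.inE v) (y (Sum.inl v)) (fun e => y (Sum.inr e)) s)

lemma symcutval_le_sweepBound (y : V ⊕ E → ℝ) {s : ℝ} (hs : 0 < s) :
    2 * s * N.symcutval (superlevel y s) ≤ N.sweepBound y s := by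
  simp only [sweepBound, ← mul_add, ← Finset.mul_sum]
  exact mul_le_mul_of_nonneg_left
    (add_le_add (N.cut_dplus_superlevel_le y s) (N.cut_dminus_superlevel_le y s)) (by positivity)

lemma integral_sweepBound_le (y : V ⊕ E → ℝ) :
    IntegrableOn (N.sweepBound y) (Set.Ioi 0) ∧
    ∀ ε, 0 < ε → ∫ s in Set.Ioi (0 : ℝ), N.sweepBound y s ≤
      4 * ε * ∑ v, N.deg v * (max 0 (y (Sum.inl v))) ^ 2 + (1 / ε + 1) * N.energy y := by
  have hpl := fun v => integral_lowerTerm_le (N.ρp_nonneg v) (N.ρp_empty v)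
    (D := N.outE v) (N.ρp_mono v) (y (Sum.inl v)) fun e => y (Sum.inr e)
  have hpu := fun v => integral_upperTerm_le (N.ρp_nonneg v) (N.ρp_empty v)
    (D := N.outE v) (N.ρp_mono v) (y (Sum.inl v)) fun e => y (Sum.inr e)
  have hml := fun v => integral_lowerTerm_le (N.ρm_nonneg v) (N.ρm_empty v)
    (D := N.inE v) (N.ρm_mono v) (y (Sum.inl v)) fun e => y (Sum.inr e)
  have hmu := fun v => integral_upperTerm_le (N.ρm_nonneg v) (N.ρm_empty v)
    (D := N.inE v) (N.ρm_mono v) (y (Sum.inl v)) fun e => y (Sum.inr e)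
  have hi1 := fun v => (hpl v).1.integrable.fun_add (hmu v).1.integrable
  have hi2 := fun v => (hpu v).1.integrable.fun_add (hml v).1.integrable
  have hs1 := integrable_finsetSum Finset.univ fun v _ => hi1 v
  have hs2 := integrable_finsetSum Finset.univ fun v _ => hi2 v
  refine ⟨hs1.add hs2, fun ε hε => ?_⟩
  have hsplit : ∫ s in Set.Ioi (0 : ℝ), N.sweepBound y s = _ := integral_add hs1 hs2
  rw [hsplit, integral_finsetSum _ fun v _ => hi1 v, integral_finsetSum _ fun v _ => hi2 v,
    energy, mul_add, Finset.mul_sum, Finset.mul_sum, Finset.mul_sum, ← Finset.sum_add_distrib,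
    ← Finset.sum_add_distrib, ← Finset.sum_add_distrib]
  refine Finset.sum_le_sum fun v _ => ?_
  have e1 := integral_add (hpl v).1.integrable (hmu v).1.integrable
  have e2 := integral_add (hpu v).1.integrable (hml v).1.integrable
  refine (add_le_add (e1.trans_le (add_le_add ((hpl v).2 ε hε) ((hmu v).2 ε hε)))
    (e2.trans_le (add_le_add ((hpu v).2 ε hε) ((hml v).2 ε hε)))).trans (le_of_eq ?_)
  rw [deg]
  ring

lemma integral_vol_superlevel (y : V ⊕ E → ℝ) :
    IntegrableOn (fun s => 2 * s * N.vol (superlevel y s)) (Set.Ioi 0) ∧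
    ∫ s in Set.Ioi (0 : ℝ), 2 * s * N.vol (superlevel y s) =
      ∑ v, N.deg v * (max 0 (y (Sum.inl v))) ^ 2 := by
  have heq : (fun s => 2 * s * N.vol (superlevel y s)) =
      fun s => ∑ v, N.deg v * (2 * s * if s ≤ y (Sum.inl v) then (1 : ℝ) else 0) := by
    funext s
    rw [vol, Finset.mul_sum]
    refine Finset.sum_congr rfl fun v _ => ?_
    by_cases hv : s ≤ y (Sum.inl v)
    · rw [Set.indicator_of_mem (show v ∈ superlevel y s from hv), if_pos hv]
      ring
    · rw [Set.indicator_of_notMem (show v ∉ superlevel y s from hv), if_neg hv]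
      ring
  have hi := fun v => (integral_threshold (y (Sum.inl v))).1.integrable.const_mul (N.deg v)
  rw [heq]
  refine ⟨integrable_finsetSum _ fun v _ => hi v, ?_⟩
  rw [integral_finsetSum _ fun v _ => hi v]
  refine Finset.sum_congr rfl fun v _ => ?_
  rw [integral_const_mul, (integral_threshold _).2]

lemma exists_median [Nonempty V] (x : V → ℝ) :
    ∃ c, N.vol {v | c < x v} ≤ N.vol Set.univ / 2 ∧ N.vol {v | x v < c} ≤ N.vol Set.univ / 2 := by
  classical
  have hvol := N.vol_nonneg Set.univ
  set A : Finset V := Finset.univ.filter fun u => N.vol {v | x u < x v} ≤ N.vol Set.univ / 2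
    with hA
  have hne : A.Nonempty := by
    obtain ⟨u, -, hu⟩ := Finset.exists_max_image Finset.univ x Finset.univ_nonempty
    refine ⟨u, Finset.mem_filter.2 ⟨Finset.mem_univ _, ?_⟩⟩
    have : {v | x u < x v} = ∅ :=
      Set.eq_empty_of_forall_notMem fun v hv => (hu v (Finset.mem_univ v)).not_gt hv
    rw [this]
    simpa [vol] using div_nonneg hvol zero_le_two
  obtain ⟨u, huA, hmin⟩ := Finset.exists_min_image A x hne
  refine ⟨x u, (Finset.mem_filter.1 huA).2, ?_⟩
  by_contra! hcon
  have hne' : (Finset.univ.filter fun v => x v < x u).Nonempty := by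
    rw [Finset.nonempty_iff_ne_empty]
    intro hemp
    have : {v | x v < x u} = ∅ := Set.eq_empty_of_forall_notMem fun v hv =>
      Finset.notMem_empty v (hemp ▸ Finset.mem_filter.2 ⟨Finset.mem_univ v, hv⟩)
    rw [this] at hcon
    simp only [vol, Set.indicator_empty, Finset.sum_const_zero] at hcon hvol
    linarith
  obtain ⟨u', hu', hmax⟩ := Finset.exists_max_image _ x hne'
  have hlt := (Finset.mem_filter.1 hu').2
  refine (hmin u' (Finset.mem_filter.2 ⟨Finset.mem_univ _, ?_⟩)).not_gt hlt
  have hsub : {v | x u' < x v} ⊆ {v | x v < x u}ᶜ := fun v hv hvu =>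
    (hmax v (Finset.mem_filter.2 ⟨Finset.mem_univ v, hvu⟩)).not_gt hv
  linarith [N.vol_mono hsub, N.vol_add_vol_compl {v | x v < x u}]

lemma sum_deg_mul_sq_le_sub_const {x : V → ℝ} (hmean : ∑ v, N.deg v * x v = 0) (c : ℝ) :
    ∑ v, N.deg v * x v ^ 2 ≤ ∑ v, N.deg v * (x v - c) ^ 2 := by
  have : ∑ v, N.deg v * (x v - c) ^ 2 =
      ∑ v, N.deg v * x v ^ 2 - 2 * c * ∑ v, N.deg v * x v + ∑ v, N.deg v * c ^ 2 := by
    rw [Finset.mul_sum, ← Finset.sum_sub_distrib, ← Finset.sum_add_distrib]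
    exact Finset.sum_congr rfl fun v _ => by ring
  rw [this, hmean]
  have : 0 ≤ ∑ v, N.deg v * c ^ 2 :=
    Finset.sum_nonneg fun v _ => mul_nonneg (N.deg_nonneg v) (sq_nonneg c)
  linarith

/-- Among the superlevel sets of `y` and `-y`, one has symmetric cut at most `K` times its
volume, provided the sweep bounds are on average at most `K` times the volumes. -/
lemma exists_superlevel_symcutval_le {y : V ⊕ E → ℝ} {K : ℝ}
    (hpos : 0 < ∑ v, N.deg v * y (Sum.inl v) ^ 2)
    (hK : (∫ s in Set.Ioi (0 : ℝ), N.sweepBound y s) +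
      ∫ s in Set.Ioi (0 : ℝ), N.sweepBound (fun i => -y i) s ≤
        K * ∑ v, N.deg v * y (Sum.inl v) ^ 2) :
    ∃ s, 0 < s ∧ ∃ S, (S = superlevel y s ∨ S = superlevel (fun i => -y i) s) ∧
      0 < N.vol S ∧ N.symcutval S ≤ K * N.vol S := by
  by_contra! hcon
  obtain ⟨v, -, hv⟩ := Finset.exists_lt_of_sum_lt (f := fun _ : V => (0 : ℝ))
    (by simpa using hpos)
  have hdeg : 0 < N.deg v := pos_of_mul_pos_left hv (sq_nonneg _)
  have hyv : y (Sum.inl v) ≠ 0 := by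
    rintro h
    simp [h] at hv
  set z : V ⊕ E → ℝ := fun i => -y i with hz
  set G : (V ⊕ E → ℝ) → ℝ → ℝ :=
    fun y s => N.sweepBound y s - K * (2 * s * N.vol (superlevel y s)) with hG
  have hGint : ∀ y, IntegrableOn (G y) (Set.Ioi 0) := fun y =>
    (N.integral_sweepBound_le y).1.sub ((N.integral_vol_superlevel y).1.const_mul K)
  have hGval : ∀ y, ∫ s in Set.Ioi (0 : ℝ), G y s = (∫ s in Set.Ioi (0 : ℝ), N.sweepBound y s) -
      K * ∑ v, N.deg v * (max 0 (y (Sum.inl v))) ^ 2 := fun y => by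
    rw [hG, integral_sub (N.integral_sweepBound_le y).1
      ((N.integral_vol_superlevel y).1.const_mul K), integral_const_mul,
      (N.integral_vol_superlevel y).2]
  have hGpos : ∀ w, w = y ∨ w = z → ∀ s, 0 < s → 0 < N.vol (superlevel w s) → 0 < G w s := by
    intro w hw s hs hvol
    have h1 := hcon s hs (superlevel w s) (by rcases hw with rfl | rfl <;> simp) hvol
    have h2 := N.symcutval_le_sweepBound w hs
    have h3 := mul_lt_mul_of_pos_left h1 (by positivity : 0 < 2 * s)
    simp only [hG]
    linarith
  have hGnonneg : ∀ w, w = y ∨ w = z → ∀ s, 0 < s → 0 ≤ G w s := by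
    intro w hw s hs
    rcases (N.vol_nonneg (superlevel w s)).eq_or_lt with h | h
    · have h2 := N.symcutval_le_sweepBound w hs
      have h3 := mul_nonneg (by positivity : 0 ≤ 2 * s) (N.symcutval_nonneg (superlevel w s))
      simp only [hG, ← h]
      linarith
    · exact (hGpos w hw s hs h).le
  have hlt : 0 < ∫ s in Set.Ioi (0 : ℝ), (G y s + G z s) := by
    rw [setIntegral_pos_iff_support_of_nonneg_ae _ ((hGint y).fun_add (hGint z))]
    · have hsub : Set.Ioc 0 |y (Sum.inl v)| ⊆
          (Function.support fun s => G y s + G z s) ∩ Set.Ioi 0 := by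
        rintro s ⟨hs0, hs⟩
        refine ⟨ne_of_gt ?_, hs0⟩
        rcases le_abs.1 hs with h | h
        · exact add_pos_of_pos_of_nonneg
            (hGpos y (Or.inl rfl) s hs0 (N.vol_pos_of_mem (v := v) h hdeg))
            (hGnonneg z (Or.inr rfl) s hs0)
        · exact add_pos_of_nonneg_of_pos (hGnonneg y (Or.inl rfl) s hs0)
            (hGpos z (Or.inr rfl) s hs0 (N.vol_pos_of_mem (v := v) h hdeg))
      refine lt_of_lt_of_le ?_ (measure_mono hsub)
      simpa using hyv
    · exact ae_restrict_of_forall_mem measurableSet_Ioi fun s hs =>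
        add_nonneg (hGnonneg y (Or.inl rfl) s hs) (hGnonneg z (Or.inr rfl) s hs)
  rw [integral_add (hGint y) (hGint z), hGval, hGval] at hlt
  have hsum : ∑ v, N.deg v * (max 0 (y (Sum.inl v))) ^ 2 +
      ∑ v, N.deg v * (max 0 (z (Sum.inl v))) ^ 2 = ∑ v, N.deg v * y (Sum.inl v) ^ 2 := by
    rw [← Finset.sum_add_distrib]
    refine Finset.sum_congr rfl fun v _ => ?_
    simp only [hz]
    rcases le_total 0 (y (Sum.inl v)) with h | h
    · rw [max_eq_right h, max_eq_left (by linarith)]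
      ring
    · rw [max_eq_left h, max_eq_right (by linarith)]
      ring
  rw [← hsum] at hK
  linarith

lemma sum_sq_posPart_le (y : V ⊕ E → ℝ) :
    ∑ v, N.deg v * (max 0 (y (Sum.inl v))) ^ 2 ≤ ∑ v, N.deg v * y (Sum.inl v) ^ 2 := by
  refine Finset.sum_le_sum fun v _ => mul_le_mul_of_nonneg_left ?_ (N.deg_nonneg v)
  rcases le_total 0 (y (Sum.inl v)) with h | h
  · rw [max_eq_right h]
  · rw [max_eq_left h]
    nlinarith

lemma integral_sweepBound_add_neg_le (y : V ⊕ E → ℝ) {r : ℝ} (hr0 : 0 ≤ r) (hr1 : r ≤ 1)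
    (hE : N.energy y ≤ r ^ 2 * ∑ v, N.deg v * y (Sum.inl v) ^ 2) :
    (∫ s in Set.Ioi (0 : ℝ), N.sweepBound y s) +
      ∫ s in Set.Ioi (0 : ℝ), N.sweepBound (fun i => -y i) s ≤
        12 * r * ∑ v, N.deg v * y (Sum.inl v) ^ 2 := by
  set Q := ∑ v, N.deg v * y (Sum.inl v) ^ 2 with hQ
  have hQ0 : 0 ≤ Q := Finset.sum_nonneg fun v _ => mul_nonneg (N.deg_nonneg v) (sq_nonneg _)
  have hb : ∀ ε, 0 < ε → (∫ s in Set.Ioi (0 : ℝ), N.sweepBound y s) +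
      ∫ s in Set.Ioi (0 : ℝ), N.sweepBound (fun i => -y i) s ≤
        8 * ε * Q + 2 * ((1 / ε + 1) * N.energy y) := by
    intro ε hε
    have h1 := (N.integral_sweepBound_le y).2 ε hε
    have h2 := (N.integral_sweepBound_le fun i => -y i).2 ε hε
    rw [N.energy_neg] at h2
    have h3 := mul_le_mul_of_nonneg_left (N.sum_sq_posPart_le y) (by positivity : 0 ≤ 4 * ε)
    have h4 := mul_le_mul_of_nonneg_left (N.sum_sq_posPart_le fun i => -y i)
      (by positivity : 0 ≤ 4 * ε)
    simp only [neg_sq] at h4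
    linarith
  rcases hr0.eq_or_lt with rfl | hr
  · have hE0 : N.energy y = 0 := le_antisymm (by simpa using hE) (N.energy_nonneg y)
    refine le_of_forall_pos_le_add fun δ hδ => ?_
    have hε : 0 < δ / (8 * (Q + 1)) := by positivity
    refine (hb _ hε).trans ?_
    rw [hE0]
    have : 8 * (δ / (8 * (Q + 1))) * Q = δ * (Q / (Q + 1)) := by
      field_simp
    rw [this]
    have : Q / (Q + 1) ≤ 1 := (div_le_one (by positivity)).2 (by linarith)
    nlinarith
  · refine (hb r hr).trans ?_
    have h1 : (1 / r + 1) * N.energy y ≤ (1 / r + 1) * (r ^ 2 * Q) :=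
      mul_le_mul_of_nonneg_left hE (by positivity)
    have h2 : (1 / r + 1) * (r ^ 2 * Q) = r * Q + r * (r * Q) := by
      field_simp
    have h3 : r * (r * Q) ≤ 1 * (r * Q) := mul_le_mul_of_nonneg_right hr1 (by positivity)
    linarith

end PolyNet

/-- Rounding a vector into a sparse symmetric cut: for any `x` with
`∑ deg_v x_v = 0` and `∑ deg_v x_v² > 0` there is a set `S` with
`0 < vol S ≤ vol V / 2` and `symcutval S ≤ 128 √(R̄(x)) · vol S`. -/
theorem cheeger_rounding_symmetric {V E : Type*} [Fintype V] [Fintype E] (N : PolyNet V E)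
    (x : V ⊕ E → ℝ) (hmean : (∑ v, N.deg v * x (Sum.inl v)) = 0)
    (hpos : 0 < ∑ v, N.deg v * (x (Sum.inl v))^2) :
    ∃ S : Set V, 0 < N.vol S ∧ N.vol S ≤ N.vol Set.univ / 2 ∧
      N.symcutval S ≤ 128 * Real.sqrt (N.RaySym x) * N.vol S := by
  have hne : Nonempty V := by
    by_contra h
    rw [not_nonempty_iff] at h
    simp at hpos
  obtain ⟨c, hc1, hc2⟩ := N.exists_median fun v => x (Sum.inl v)
  set y : V ⊕ E → ℝ := fun i => x i - c with hy
  have hQ : ∑ v, N.deg v * x (Sum.inl v) ^ 2 ≤ ∑ v, N.deg v * y (Sum.inl v) ^ 2 :=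
    N.sum_deg_mul_sq_le_sub_const hmean c
  have hQpos := hpos.trans_le hQ
  have hhalf : ∀ s, 0 < s → ∀ S,
      (S = PolyNet.superlevel y s ∨ S = PolyNet.superlevel (fun i => -y i) s) →
      N.vol S ≤ N.vol Set.univ / 2 := by
    rintro s hs S (rfl | rfl)
    · refine (N.vol_mono fun v hv => ?_).trans hc1
      have hv' : s ≤ x (Sum.inl v) - c := hv
      exact show c < x (Sum.inl v) by linarith
    · refine (N.vol_mono fun v hv => ?_).trans hc2
      have hv' : s ≤ -(x (Sum.inl v) - c) := hv
      exact show x (Sum.inl v) < c by linarith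
  have hR0 : 0 ≤ N.RaySym x := by
    rw [N.RaySym_eq]
    exact div_nonneg (N.energy_nonneg x) hpos.le
  set r := Real.sqrt (N.RaySym x) with hr
  have hr0 : 0 ≤ r := Real.sqrt_nonneg _
  rcases le_total r 1 with hr1 | hr1
  · have hE : N.energy y ≤ r ^ 2 * ∑ v, N.deg v * y (Sum.inl v) ^ 2 := by
      rw [hy, N.energy_sub_const, hr, Real.sq_sqrt hR0]
      refine le_trans (le_of_eq ?_) (mul_le_mul_of_nonneg_left hQ hR0)
      rw [N.RaySym_eq, div_mul_cancel₀ _ hpos.ne']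
    obtain ⟨s, hs, S, hS, hvol, hcut⟩ := N.exists_superlevel_symcutval_le hQpos
      (N.integral_sweepBound_add_neg_le y hr0 hr1 hE)
    refine ⟨S, hvol, hhalf s hs S hS, hcut.trans ?_⟩
    exact mul_le_mul_of_nonneg_right (by linarith) hvol.le
  · obtain ⟨s, hs, S, hS, hvol, -⟩ := N.exists_superlevel_symcutval_le hQpos
      (le_of_eq (div_mul_cancel₀ _ hQpos.ne').symm)
    refine ⟨S, hvol, hhalf s hs S hS, (N.symcutval_le_vol S).trans ?_⟩
    exact le_mul_of_one_le_left hvol.le (by linarith)
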